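/- Let k be an algebraically closed field with char(k) ≠ 2. Let G be a subgroup of Aut_k(k(x,y)) such that every element of G maps the subfield k(x) onto itself. If G is isomorphic to (ℤ/2)^r, then r ≤ 4. -/

import Mathlib

/-- The field `k(x,y)` of rational functions in two variables over `k`. -/
noncomputable abbrev Kxy (k : Type*) [Field k] : Type _ :=
  FractionRing (MvPolynomial (Fin 2) k)

/-- The images of the variables `x = X 0` and `y = X 1` in `k(x,y)`. -/
noncomputable abbrev Xv (k : Type*) [Field k] (i : Fin 2) : Kxy k :=
  algebraMap (MvPolynomial (Fin 2) k) (Kxy k) (MvPolynomial.X i)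

/-- The subfield `k(x) ⊆ k(x,y)`. -/
noncomputable abbrev Kx (k : Type*) [Field k] : IntermediateField k (Kxy k) :=
  IntermediateField.adjoin k {Xv k 0}

/-- Three traceless invertible `2 × 2` matrices, pairwise orthogonal for the trace form, have a
product of nonzero trace. -/
theorem false_of_trace_products_eq_zero {K : Type*} [Field K] (two_ne : (2 : K) ≠ 0)
    (M N P : Matrix (Fin 2) (Fin 2) K) (hM : M.det ≠ 0) (hN : N.det ≠ 0) (hP : P.det ≠ 0)
    (tM : M.trace = 0) (tN : N.trace = 0) (tP : P.trace = 0)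
    (tNM : (N * M).trace = 0) (tPM : (P * M).trace = 0) (tPN : (P * N).trace = 0)
    (tPNM : (P * (N * M)).trace = 0) : False := by
  rw [Matrix.trace_fin_two] at *
  simp only [Matrix.det_fin_two, Matrix.mul_apply, Fin.sum_univ_two] at *
  grind

/-- If an elementary abelian 2-group has order greater than 4, it contains three independent
elements. -/
theorem exists_independent_involutions {Q : Type*} [Group Q] (hQ : ∀ g : Q, g * g = 1)
    (hcard : 4 < Nat.card Q) :
    ∃ a b c : Q, a ≠ 1 ∧ b ≠ 1 ∧ c ≠ 1 ∧ a * b ≠ 1 ∧ a * c ≠ 1 ∧ b * c ≠ 1 ∧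
      a * b * c ≠ 1 := by
  classical
  have : Finite Q := Nat.finite_of_card_ne_zero (by omega)
  have : Fintype Q := Fintype.ofFinite Q
  rw [Nat.card_eq_fintype_card] at hcard
  have key (s : Finset Q) (hs : s.card ≤ 4) : ∃ x, x ∉ s := by
    by_contra! h
    have := Finset.card_le_card (show Finset.univ ⊆ s from fun x _ ↦ h x)
    rw [Finset.card_univ] at this
    omega
  have eq_of (g h : Q) (hgh : g * h = 1) : h = g := by
    rw [eq_inv_of_mul_eq_one_right hgh, inv_eq_of_mul_eq_one_right (hQ g)]
  obtain ⟨a, ha⟩ := key {1} (by simp)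
  obtain ⟨b, hb⟩ := key {1, a} (Finset.card_le_two.trans (by norm_num))
  obtain ⟨c, hc⟩ := key {1, a, b, a * b} Finset.card_le_four
  simp only [Finset.mem_insert, Finset.mem_singleton, not_or] at ha hb hc
  exact ⟨a, b, c, ha, hb.1, hc.1, fun h ↦ hb.2 (eq_of _ _ h), fun h ↦ hc.2.1 (eq_of _ _ h),
    fun h ↦ hc.2.2.1 (eq_of _ _ h), fun h ↦ hc.2.2.2 (eq_of _ _ h)⟩

open IntermediateField

/-- A rational function generating `K(X)` is a Möbius transformation of `X`. -/
theorem RatFunc.exists_matrix_of_adjoin_eq_top {K : Type*} [Field K] (f : RatFunc K)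
    (hf : K⟮f⟯ = ⊤) : ∃ M : Matrix (Fin 2) (Fin 2) K, M.det ≠ 0 ∧
      f * (algebraMap K _ (M 1 0) * RatFunc.X + algebraMap K _ (M 1 1)) =
        algebraMap K _ (M 0 0) * RatFunc.X + algebraMap K _ (M 0 1) := by
  have hdeg : max f.num.natDegree f.denom.natDegree = 1 := by
    rw [← RatFunc.finrank_eq_max_natDegree, hf, IntermediateField.finrank_top]
  obtain ⟨a, b, hnum⟩ := Polynomial.exists_eq_X_add_C_of_natDegree_le_one
    ((le_max_left _ _).trans hdeg.le)
  obtain ⟨c, d, hden⟩ := Polynomial.exists_eq_X_add_C_of_natDegree_le_one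
    ((le_max_right _ _).trans hdeg.le)
  have hrel : f * (RatFunc.C c * RatFunc.X + RatFunc.C d) =
      RatFunc.C a * RatFunc.X + RatFunc.C b := by
    have h := RatFunc.num_div_denom f
    rw [div_eq_iff (by simpa using f.denom_ne_zero), hnum, hden] at h
    simpa using h.symm
  refine ⟨!![a, b; c, d], fun hdet ↦ ?_, by simpa using hrel⟩
  rw [Matrix.det_fin_two_of] at hdet
  have hden0 : RatFunc.C c * RatFunc.X + RatFunc.C d ≠ (0 : RatFunc K) := by
    have := f.denom_ne_zero
    rw [hden] at this
    simpa using (RatFunc.algebraMap_ne_zero this)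
  have hdet' : RatFunc.C a * RatFunc.C d = RatFunc.C b * RatFunc.C c := by
    rw [← map_mul, ← map_mul, sub_eq_zero.mp hdet]
  have hconst : ∃ e, f = RatFunc.C e := by
    by_cases hc : c = 0
    · have hd : RatFunc.C d ≠ (0 : RatFunc K) := by
        rintro h
        simp [hc, h] at hden0
      have ha : RatFunc.C a = (0 : RatFunc K) := by
        simpa [hc, hd] using hdet'
      refine ⟨b / d, ?_⟩
      rw [map_div₀, eq_div_iff hd]
      simpa [hc, ha] using hrel
    · have hc' : RatFunc.C c ≠ (0 : RatFunc K) := by simpa using hc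
      refine ⟨a / c, ?_⟩
      rw [map_div₀, eq_div_iff hc']
      apply mul_right_cancel₀ hden0
      linear_combination RatFunc.C c * hrel - hdet'
  obtain ⟨e, rfl⟩ := hconst
  simp at hdeg

section Moebius

variable {K L : Type*} [Field K] [Field L] [Algebra K L]

/-- The endomorphism `σ` acts on `y` as the Möbius transformation given by `M`. -/
def ActsAs (y : L) (M : Matrix (Fin 2) (Fin 2) K) (σ : L →ₐ[K] L) : Prop :=
  M.det ≠ 0 ∧ σ y * (algebraMap K L (M 1 0) * y + algebraMap K L (M 1 1)) =
    algebraMap K L (M 0 0) * y + algebraMap K L (M 0 1)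

theorem ActsAs.mul {y : L} {M N : Matrix (Fin 2) (Fin 2) K} {σ τ : L →ₐ[K] L}
    (hσ : ActsAs y M σ) (hτ : ActsAs y N τ) : ActsAs y (N * M) (σ * τ) := by
  refine ⟨by rw [Matrix.det_mul]; exact mul_ne_zero hτ.1 hσ.1, ?_⟩
  have h₁ := hσ.2
  have h₂ := congrArg σ hτ.2
  simp only [map_mul, map_add, AlgHom.commutes] at h₂
  simp only [Matrix.mul_apply, Fin.sum_univ_two, map_add, map_mul, AlgHom.mul_apply]
  generalize algebraMap K L (M 1 0) = c at *
  generalize algebraMap K L (M 1 1) = d at *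
  linear_combination (c * y + d) * h₂ + (algebraMap K L (N 0 0)
    - σ (τ y) * algebraMap K L (N 1 0)) * h₁

theorem ActsAs.entries_of_one {y : L} (hy : Transcendental K y) {M : Matrix (Fin 2) (Fin 2) K}
    (h : ActsAs y M 1) : M 1 0 = 0 ∧ M 0 1 = 0 ∧ M 0 0 = M 1 1 := by
  have h' := h.2
  rw [transcendental_iff] at hy
  have hp := hy (Polynomial.C (M 1 0) * Polynomial.X ^ 2
    + Polynomial.C (M 1 1 - M 0 0) * Polynomial.X + Polynomial.C (-M 0 1)) (by
      simp only [AlgHom.one_apply] at h'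
      simp only [map_add, map_mul, map_pow, Polynomial.aeval_C, Polynomial.aeval_X, map_sub,
        map_neg]
      linear_combination h')
  have h0 := congrArg (Polynomial.coeff · 0) hp
  have h1 := congrArg (Polynomial.coeff · 1) hp
  have h2 := congrArg (Polynomial.coeff · 2) hp
  simp [Polynomial.coeff_X, Polynomial.coeff_C] at h0 h1 h2
  exact ⟨h2, h0, (sub_eq_zero.mp h1).symm⟩

/-- A Möbius transformation of order exactly two is given by a traceless matrix. -/
theorem ActsAs.trace_eq_zero {y : L} (hy : Transcendental K y) (hgen : K⟮y⟯ = ⊤)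
    {M : Matrix (Fin 2) (Fin 2) K} {σ : L →ₐ[K] L} (h : ActsAs y M σ)
    (hsq : σ * σ = 1) (hne : σ ≠ 1) : M.trace = 0 := by
  have hs := h.mul h
  rw [hsq] at hs
  obtain ⟨h10, h01, h00⟩ := hs.entries_of_one hy
  simp only [Matrix.mul_apply, Fin.sum_univ_two] at h10 h01 h00
  rw [Matrix.trace_fin_two]
  by_contra ht
  have e10 : M 1 0 = 0 := mul_right_cancel₀ ht (by linear_combination h10)
  have e01 : M 0 1 = 0 := mul_right_cancel₀ ht (by linear_combination h01)
  have e00 : M 0 0 = M 1 1 := mul_right_cancel₀ ht (by linear_combination h00)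
  obtain ⟨hdet, hrel⟩ := h
  rw [Matrix.det_fin_two, e10, mul_zero, sub_zero, e00] at hdet
  have hd : algebraMap K L (M 1 1) ≠ 0 := by
    simpa using left_ne_zero_of_mul hdet
  simp only [e10, e01, e00, map_zero, zero_mul, zero_add, add_zero] at hrel
  have hfix : σ y = y := mul_right_cancel₀ hd (by linear_combination hrel)
  apply hne
  have hcomp : σ.comp (⊤ : IntermediateField K L).val
      = (1 : L →ₐ[K] L).comp (⊤ : IntermediateField K L).val :=
    IntermediateField.algHom_ext_of_eq_adjoin K hgen.symm fun x hx ↦ by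
      obtain rfl := Set.mem_singleton_iff.mp hx
      exact hfix
  exact AlgHom.ext fun z ↦ DFunLike.congr_fun hcomp ⟨z, IntermediateField.mem_top⟩

theorem exists_actsAs {y : L} (hy : Transcendental K y) (hgen : K⟮y⟯ = ⊤) (σ : L →ₐ[K] L)
    (hσ : Function.Surjective σ) : ∃ M : Matrix (Fin 2) (Fin 2) K, ActsAs y M σ := by
  let e : RatFunc K ≃ₐ[K] L := (RatFunc.algEquivOfTranscendental y hy).trans
    ((IntermediateField.equivOfEq hgen).trans IntermediateField.topEquiv)
  have heX : e RatFunc.X = y := RatFunc.algEquivOfTranscendental_X y hy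
  have hf : K⟮e.symm (σ y)⟯ = ⊤ := by
    have h := congrArg (IntermediateField.map ((e.symm : L →ₐ[K] RatFunc K).comp σ)) hgen
    rw [IntermediateField.adjoin_map, Set.image_singleton] at h
    rw [← AlgHom.fieldRange_eq_map] at h
    refine h.trans ?_
    rw [AlgHom.fieldRange_eq_top]
    exact e.symm.surjective.comp hσ
  obtain ⟨M, hM, hrel⟩ := RatFunc.exists_matrix_of_adjoin_eq_top _ hf
  refine ⟨M, hM, ?_⟩
  simpa only [map_mul, map_add, AlgEquiv.commutes, heX, AlgEquiv.apply_symm_apply]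
    using congrArg e hrel

/-- An elementary abelian 2-group acts on `K(y)` through a quotient of order at most four. -/
theorem index_ker_le_four (two_ne : (2 : K) ≠ 0) {y : L} (hy : Transcendental K y)
    (hgen : K⟮y⟯ = ⊤) {Γ : Type*} [Group Γ] (hΓ : ∀ g : Γ, g * g = 1)
    (φ : Γ →* (L →ₐ[K] L)) : φ.ker.index ≤ 4 := by
  by_contra! hcard
  have hsq (g : Γ) : φ g * φ g = 1 := by rw [← map_mul, hΓ, map_one]
  have hsurj (g : Γ) : Function.Surjective (φ g) := fun z ↦
    ⟨φ g z, DFunLike.congr_fun (hsq g) z⟩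
  have hQ (q : Γ ⧸ φ.ker) : q * q = 1 := by
    obtain ⟨g, rfl⟩ := QuotientGroup.mk_surjective q
    rw [← QuotientGroup.mk_mul, hΓ, QuotientGroup.mk_one]
  obtain ⟨a, b, c, ha, hb, hc, hab, hac, hbc, habc⟩ := exists_independent_involutions hQ hcard
  obtain ⟨a, rfl⟩ := QuotientGroup.mk_surjective a
  obtain ⟨b, rfl⟩ := QuotientGroup.mk_surjective b
  obtain ⟨c, rfl⟩ := QuotientGroup.mk_surjective c
  simp only [← QuotientGroup.mk_mul, ne_eq, QuotientGroup.eq_one_iff, MonoidHom.mem_ker]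
    at ha hb hc hab hac hbc habc
  have tr {g : Γ} {M : Matrix (Fin 2) (Fin 2) K} (hg : ¬ φ g = 1) (h : ActsAs y M (φ g)) :
      M.trace = 0 := h.trace_eq_zero hy hgen (hsq g) hg
  obtain ⟨M, hM⟩ := exists_actsAs hy hgen (φ a) (hsurj a)
  obtain ⟨N, hN⟩ := exists_actsAs hy hgen (φ b) (hsurj b)
  obtain ⟨P, hP⟩ := exists_actsAs hy hgen (φ c) (hsurj c)
  refine false_of_trace_products_eq_zero two_ne M N P hM.1 hN.1 hP.1 (tr ha hM) (tr hb hN)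
    (tr hc hP) (tr hab ?_) (tr hac ?_) (tr hbc ?_) (tr habc ?_)
  · simpa only [map_mul] using hM.mul hN
  · simpa only [map_mul] using hM.mul hP
  · simpa only [map_mul] using hN.mul hP
  · simpa only [map_mul] using (hM.mul hN).mul hP

end Moebius

section RationalFunctions

variable (k : Type*) [Field k]

theorem algebraicIndependent_Xv : AlgebraicIndependent k (Xv k) :=
  (MvPolynomial.algebraicIndependent_X (Fin 2) k).map'
    (f := IsScalarTower.toAlgHom k (MvPolynomial (Fin 2) k) (Kxy k))
    (IsFractionRing.injective (MvPolynomial (Fin 2) k) (Kxy k))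

theorem transcendental_Xv_one : Transcendental (Kx k) (Xv k 1) := by
  have h := (algebraicIndependent_Xv k).transcendental_adjoin (s := {0}) (i := 1) (by simp)
  rw [Set.image_singleton] at h
  exact IntermediateField.transcendental_adjoin_iff.mpr h

theorem adjoin_Xv_one : IntermediateField.adjoin (Kx k) {Xv k 1} = ⊤ := by
  apply IntermediateField.restrictScalars_injective k
  rw [IntermediateField.adjoin_adjoin_left, IntermediateField.restrictScalars_top, eq_top_iff]
  set F := IntermediateField.adjoin k ({Xv k 0} ∪ {Xv k 1} : Set (Kxy k))
  have hpoly (p : MvPolynomial (Fin 2) k) : algebraMap _ (Kxy k) p ∈ F := by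
    induction p using MvPolynomial.induction_on with
    | C a => exact F.algebraMap_mem a
    | add p q hp hq => rw [map_add]; exact add_mem hp hq
    | mul_X p i hp =>
      rw [map_mul]
      refine mul_mem hp (IntermediateField.subset_adjoin _ _ ?_)
      fin_cases i <;> simp
  intro z _
  obtain ⟨p, q, _, rfl⟩ := IsFractionRing.div_surjective (A := MvPolynomial (Fin 2) k) z
  exact div_mem (hpoly p) (hpoly q)

/-- Restriction to `k(x)` of automorphisms of `k(x,y)` preserving it. -/
noncomputable def restrictKx (G : Subgroup (Kxy k ≃ₐ[k] Kxy k))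
    (hG : ∀ σ ∈ G, ∀ z ∈ Kx k, σ z ∈ Kx k) : G →* (Kx k →ₐ[k] Kx k) where
  toFun σ := ((σ.1 : Kxy k →ₐ[k] Kxy k).comp (Kx k).val).codRestrict (Kx k).toSubalgebra
    fun z ↦ hG σ.1 σ.2 z z.2
  map_one' := by ext; rfl
  map_mul' σ τ := by ext; rfl

/-- Automorphisms restricting to the identity on `k(x)` are `k(x)`-linear. -/
noncomputable def kerToAlgHom (G : Subgroup (Kxy k ≃ₐ[k] Kxy k))
    (hG : ∀ σ ∈ G, ∀ z ∈ Kx k, σ z ∈ Kx k) :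
    (restrictKx k G hG).ker →* (Kxy k →ₐ[Kx k] Kxy k) where
  toFun σ :=
    { (σ.1.1 : Kxy k →+* Kxy k) with
      commutes' := fun z ↦
        congrArg Subtype.val (DFunLike.congr_fun (MonoidHom.mem_ker.mp σ.2) z) }
  map_one' := by ext; rfl
  map_mul' σ τ := by ext; rfl

theorem ker_kerToAlgHom (G : Subgroup (Kxy k ≃ₐ[k] Kxy k))
    (hG : ∀ σ ∈ G, ∀ z ∈ Kx k, σ z ∈ Kx k) : (kerToAlgHom k G hG).ker = ⊥ := by
  rw [eq_bot_iff]
  intro σ hσ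
  rw [Subgroup.mem_bot]
  apply Subtype.ext
  apply Subtype.ext
  apply AlgEquiv.ext
  exact fun z ↦ DFunLike.congr_fun (MonoidHom.mem_ker.mp hσ) z

theorem exists_generator_Kx :
    ∃ x : Kx k, Transcendental k x ∧ IntermediateField.adjoin k {x} = ⊤ := by
  have h0 : Transcendental k (Xv k 0) := (algebraicIndependent_Xv k).transcendental 0
  refine ⟨IntermediateField.AdjoinSimple.gen k (Xv k 0), ?_, ?_⟩
  · exact (transcendental_algebraMap_iff
      (FaithfulSMul.algebraMap_injective (Kx k) (Kxy k))).mp h0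
  · apply IntermediateField.map_injective (Kx k).val
    rw [IntermediateField.adjoin_map, Set.image_singleton, ← AlgHom.fieldRange_eq_map,
      IntermediateField.fieldRange_val]
    rfl

end RationalFunctions

/-- `k` algebraically closed with `char k ≠ 2`, `G ≤ Aut_k(k(x,y))`
whose elements all map `k(x)` onto itself. If `G ≅ (ℤ/2)^r` then `r ≤ 4`. -/
theorem two_elementary_P1_fibration_rank_le_four
    (k : Type*) [Field k] [IsAlgClosed k] (hchar : ringChar k ≠ 2)
    (r : ℕ) (G : Subgroup (Kxy k ≃ₐ[k] Kxy k))
    (hGx : ∀ σ ∈ G, (⇑σ) '' (Kx k : Set (Kxy k)) = (Kx k : Set (Kxy k)))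
    (hG : Nonempty (G ≃* Multiplicative (Fin r → ZMod 2))) :
    r ≤ 4 := by
  obtain ⟨e⟩ := hG
  have two_ne : (2 : k) ≠ 0 := Ring.two_ne_zero hchar
  have two_ne' : (2 : Kx k) ≠ 0 := by
    simpa only [map_ofNat] using (map_ne_zero (algebraMap k (Kx k))).mpr two_ne
  have hsq (g : G) : g * g = 1 := by
    apply e.injective
    rw [map_mul, map_one]
    exact Multiplicative.toAdd.injective (funext fun i ↦ CharTwo.add_self_eq_zero _)
  have hmem : ∀ σ ∈ G, ∀ z ∈ Kx k, σ z ∈ Kx k := fun σ hσ z hz ↦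
    (hGx σ hσ).subset (Set.mem_image_of_mem σ hz)
  obtain ⟨x, hx, hxgen⟩ := exists_generator_Kx k
  have hindex := index_ker_le_four two_ne hx hxgen hsq (restrictKx k G hmem)
  have hker := index_ker_le_four two_ne' (transcendental_Xv_one k) (adjoin_Xv_one k)
    (fun g ↦ Subtype.ext (hsq g.1)) (kerToAlgHom k G hmem)
  rw [ker_kerToAlgHom, Subgroup.index_bot] at hker
  have hcard : Nat.card G = 2 ^ r := by
    rw [Nat.card_congr e.toEquiv, Nat.card_congr Multiplicative.toAdd]
    simp
  rw [← Subgroup.card_mul_index (restrictKx k G hmem).ker] at hcard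
  have hle : 2 ^ r ≤ 2 ^ 4 :=
    hcard.symm.trans_le ((Nat.mul_le_mul hker hindex).trans (by norm_num))
  exact (Nat.pow_le_pow_iff_right (by norm_num)).mp hle
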